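/- The function q(t) = (t^2 + 1 - √(1 - 4t + 2t^2 + t^4))/(2t) is strictly increasing on (0, ρ), where ρ is the unique real root of 1 - 3t - t^2 - t^3 in (0,1), and satisfies 1 < q(t) and q(t) ≤ (t^2+1)/(2t) there. -/

import Mathlib

/-- The smaller root `q` of `t * x ^ 2 - (t ^ 2 + 1) * x + 1` exceeds `1` for `0 < t < 1`. -/
theorem one_lt_smallerRoot {t : ℝ} (h0 : 0 < t) (h1 : t < 1) :
    1 < (t^2 + 1 - Real.sqrt (1 - 4*t + 2*t^2 + t^4)) / (2*t) := by
  have hs : Real.sqrt (1 - 4*t + 2*t^2 + t^4) < (1 - t)^2 := by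
    rw [Real.sqrt_lt' (pow_pos (sub_pos.2 h1) 2)]
    nlinarith [mul_pos (pow_pos h0 2) (sub_pos.2 h1)]
  rw [lt_div_iff₀ (by linarith)]
  linarith

theorem smallerRoot_isRoot {t : ℝ} (h0 : 0 < t) (hD : 0 ≤ 1 - 4*t + 2*t^2 + t^4) :
    t * ((t^2 + 1 - Real.sqrt (1 - 4*t + 2*t^2 + t^4)) / (2*t))^2
      - (t^2 + 1) * ((t^2 + 1 - Real.sqrt (1 - 4*t + 2*t^2 + t^4)) / (2*t)) + 1 = 0 := by
  have hs := Real.sq_sqrt hD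
  generalize Real.sqrt (1 - 4*t + 2*t^2 + t^4) = r at hs ⊢
  field_simp
  linarith

theorem smallerRoot_lt_of_neg {s x : ℝ} (h0 : 0 < s) (hx : s * x^2 - (s^2 + 1) * x + 1 < 0) :
    (s^2 + 1 - Real.sqrt (1 - 4*s + 2*s^2 + s^4)) / (2*s) < x := by
  have h : s^2 + 1 - 2*s*x < Real.sqrt (1 - 4*s + 2*s^2 + s^4) := by
    apply Real.lt_sqrt_of_sq_lt
    nlinarith [mul_neg_of_pos_of_neg h0 hx]
  rw [div_lt_iff₀ (by linarith)]
  linarith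

theorem stmt_12 (ρ : ℝ) (hρ0 : 0 < ρ) (hρ1 : ρ < 1)
    (hρ : 1 - 3*ρ - ρ^2 - ρ^3 = 0) :
    StrictMonoOn (fun t : ℝ =>
      (t^2 + 1 - Real.sqrt (1 - 4*t + 2*t^2 + t^4)) / (2*t)) (Set.Ioo 0 ρ) ∧
    ∀ t ∈ Set.Ioo (0:ℝ) ρ,
      1 < (t^2 + 1 - Real.sqrt (1 - 4*t + 2*t^2 + t^4)) / (2*t) ∧
      (t^2 + 1 - Real.sqrt (1 - 4*t + 2*t^2 + t^4)) / (2*t) ≤ (t^2 + 1) / (2*t) := by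
  refine ⟨?_, ?_⟩
  · rintro s ⟨hs0, hsρ⟩ t ⟨ht0, htρ⟩ hst
    have hρ3 : ρ < 1 / 3 := by linarith [pow_pos hρ0 2, pow_pos hρ0 3]
    have hD : 0 ≤ 1 - 4*t + 2*t^2 + t^4 := by
      have h2 : t^2 ≤ ρ^2 := by gcongr
      have h3 : t^3 ≤ ρ^3 := by gcongr
      have h : 0 ≤ (1 - t) * (1 - 3*t - t^2 - t^3) :=
        mul_nonneg (by linarith) (by linarith)
      linarith
    have hq1 := one_lt_smallerRoot ht0 (htρ.trans hρ1)
    have hq := smallerRoot_isRoot ht0 hD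
    apply smallerRoot_lt_of_neg hs0
    beta_reduce
    generalize (t^2 + 1 - Real.sqrt (1 - 4*t + 2*t^2 + t^4)) / (2*t) = q at hq1 hq ⊢
    have h : 0 < (t - s) * (q * (q - (t + s))) :=
      mul_pos (by linarith) (mul_pos (by linarith) (by linarith))
    linarith
  · rintro t ⟨ht0, htρ⟩
    refine ⟨one_lt_smallerRoot ht0 (htρ.trans hρ1), ?_⟩
    gcongr
    exact sub_le_self _ (Real.sqrt_nonneg _)
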